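/- arXiv:1409.0341 — 5 statements merged into one kernel-verified Lean document; each statement's English description precedes it below -/
import Mathlib

section
/- Let d ≥ 1, N ≥ 1, and let (p_x = 1/N, φ_x)_{x=1}^N be a uniformly distributed 2-design in dimension d. Let Π be a nonzero effect on ℂ^d (a positive semidefinite d×d complex matrix with Π ≤ I). Then the numbers p_{x|Π} := (d/N)·⟨φ_x, Π φ_x⟩ / Tr[Π] form a probability distribution, and its Shannon entropy satisfies H ≥ log₂( (N(d+1)/d) · Tr[Π]² / (Tr[Π]² + Tr[Π²]) ). -/
open Matrix Finset
open scoped Kronecker BigOperators ComplexOrder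

/-- The rank-one operator `|φ⟩⟨φ|` associated to a vector `φ : Fin d → ℂ`. -/
noncomputable def outerProd {d : ℕ} (φ : Fin d → ℂ) : Matrix (Fin d) (Fin d) ℂ :=
  Matrix.vecMulVec φ (star φ)

/-- The swap operator `S` on `ℂ^d ⊗ ℂ^d`, determined by `S (u ⊗ v) = v ⊗ u`. -/
noncomputable def swapMatrix (d : ℕ) : Matrix (Fin d × Fin d) (Fin d × Fin d) ℂ :=
  Matrix.of fun p q => if p.1 = q.2 ∧ p.2 = q.1 then 1 else 0

/-- `(p, φ)` is a spherical quantum 2-design in dimension `d`: the `φ x` are unit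
vectors, the weights `p x` are nonnegative and sum to one, and
`Σ_x p_x (|φ_x⟩⟨φ_x|)^{⊗2} = (I + S)/(d(d+1))`. -/
noncomputable def IsTwoDesign {d N : ℕ} (p : Fin N → ℝ) (φ : Fin N → Fin d → ℂ) : Prop :=
  (∀ x, 0 ≤ p x) ∧ (∑ x, p x = 1) ∧ (∀ x, star (φ x) ⬝ᵥ φ x = 1) ∧
  (∑ x, (p x : ℂ) • (outerProd (φ x) ⊗ₖ outerProd (φ x))
      = (((d : ℂ) * ((d : ℂ) + 1))⁻¹) • (1 + swapMatrix d))

/-- The expectation value `⟨φ, A φ⟩` is the trace of `A |φ⟩⟨φ|`. -/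
theorem star_dotProduct_mulVec_eq_trace {d : ℕ} (A : Matrix (Fin d) (Fin d) ℂ)
    (φ : Fin d → ℂ) : star φ ⬝ᵥ A.mulVec φ = (A * outerProd φ).trace := by
  rw [outerProd, Matrix.mul_vecMulVec, Matrix.trace_vecMulVec, dotProduct_comm]

theorem trace_kronecker_mul_swapMatrix {d : ℕ} (A B : Matrix (Fin d) (Fin d) ℂ) :
    ((A ⊗ₖ B) * swapMatrix d).trace = (A * B).trace := by
  simp only [Matrix.trace, Matrix.diag, Matrix.mul_apply, swapMatrix, Matrix.of_apply,
    Fintype.sum_prod_type, Matrix.kroneckerMap_apply, mul_ite, mul_one, mul_zero, ite_and]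
  simp

/-- Second moments of expectation values over a 2-design. -/
theorem IsTwoDesign.sum_expectation_mul {d N : ℕ} {p : Fin N → ℝ} {φ : Fin N → Fin d → ℂ}
    (h : IsTwoDesign p φ) (A B : Matrix (Fin d) (Fin d) ℂ) :
    ∑ x, (p x : ℂ) * ((star (φ x) ⬝ᵥ A.mulVec (φ x)) * (star (φ x) ⬝ᵥ B.mulVec (φ x))) =
      ((d : ℂ) * ((d : ℂ) + 1))⁻¹ * (A.trace * B.trace + (A * B).trace) := by
  have key := congrArg (fun M => ((A ⊗ₖ B) * M).trace) h.2.2.2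
  simpa only [Matrix.mul_sum, Matrix.trace_sum, Matrix.mul_smul, Matrix.trace_smul,
    ← Matrix.mul_kronecker_mul, Matrix.trace_kronecker, Matrix.mul_add, Matrix.mul_one,
    Matrix.trace_add, trace_kronecker_mul_swapMatrix, smul_eq_mul,
    ← star_dotProduct_mulVec_eq_trace] using key

/-- First moments of expectation values over a 2-design. -/
theorem IsTwoDesign.sum_expectation {d N : ℕ} {p : Fin N → ℝ} {φ : Fin N → Fin d → ℂ}
    (hd : 1 ≤ d) (h : IsTwoDesign p φ) (A : Matrix (Fin d) (Fin d) ℂ) :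
    ∑ x, (p x : ℂ) * (star (φ x) ⬝ᵥ A.mulVec (φ x)) = (d : ℂ)⁻¹ * A.trace := by
  have key := h.sum_expectation_mul A 1
  simp only [Matrix.one_mulVec, h.2.2.1, mul_one, Matrix.trace_one, Fintype.card_fin] at key
  rw [key]
  have hd0 : (d : ℂ) ≠ 0 := by exact_mod_cast (by omega : d ≠ 0)
  have hd1 : (d : ℂ) + 1 ≠ 0 := by exact_mod_cast (by omega : d + 1 ≠ 0)
  field_simp

/-- The Shannon entropy dominates the collision entropy. -/
theorem logb_inv_sum_sq_le_entropy {ι : Type*} [Fintype ι] (q : ι → ℝ)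
    (hq : ∀ x, 0 ≤ q x) (hsum : ∑ x, q x = 1) :
    Real.logb 2 (∑ x, q x ^ 2)⁻¹ ≤ -∑ x, q x * Real.logb 2 (q x) := by
  set s := ∑ x, q x ^ 2 with hs
  have hs0 : 0 < s := by
    refine lt_of_le_of_ne (Finset.sum_nonneg fun x _ => sq_nonneg _) fun h0 => ?_
    have hz := (Finset.sum_eq_zero_iff_of_nonneg fun x _ => sq_nonneg (q x)).1 h0.symm
    have : ∑ x, q x = 0 := Finset.sum_eq_zero fun x hx => pow_eq_zero_iff two_ne_zero |>.1 (hz x hx)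
    linarith
  have hterm : ∀ x, q x * Real.log (q x) ≤ q x * Real.log s + (q x ^ 2 / s - q x) := by
    intro x
    rcases (hq x).eq_or_lt with h0 | hpos
    · simp [← h0]
    · have hlog := Real.log_le_sub_one_of_pos (div_pos hpos hs0)
      rw [Real.log_div hpos.ne' hs0.ne'] at hlog
      calc q x * Real.log (q x) ≤ q x * (Real.log s + (q x / s - 1)) :=
            mul_le_mul_of_nonneg_left (by linarith) hpos.le
        _ = _ := by ring
  have hle : ∑ x, q x * Real.log (q x) ≤ Real.log s := by
    refine (Finset.sum_le_sum fun x _ => hterm x).trans_eq ?_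
    rw [Finset.sum_add_distrib, Finset.sum_sub_distrib, ← Finset.sum_mul, ← Finset.sum_div,
      hsum, ← hs, div_self hs0.ne']
    ring
  rw [Real.logb_inv, neg_le_neg_iff]
  simp only [Real.logb, mul_div_assoc', ← Finset.sum_div]
  exact div_le_div_of_nonneg_right hle (Real.log_nonneg one_le_two)

/-- Entropic bound for uniformly distributed 2-design ensembles: the outcome
probabilities `p_{x|Π} = (d/N)⟨φ_x, Π φ_x⟩/Tr[Π]` form a probability distribution whose
Shannon entropy is at least `log₂( (N(d+1)/d)·Tr[Π]²/(Tr[Π]² + Tr[Π²]) )`. -/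
theorem entropy_bound_two_design_ensemble {d N : ℕ} (hd : 1 ≤ d) (hN : 1 ≤ N)
    (p : Fin N → ℝ) (φ : Fin N → Fin d → ℂ)
    (hdesign : IsTwoDesign p φ) (hunif : ∀ x, p x = 1 / N)
    (Pt : Matrix (Fin d) (Fin d) ℂ) (hPt : Pt.PosSemidef)
    (hPtle : (1 - Pt).PosSemidef) (hPtne : Pt ≠ 0) :
    (∀ x, 0 ≤ ((d : ℝ) / N) * (star (φ x) ⬝ᵥ Pt.mulVec (φ x)).re / Pt.trace.re) ∧
    (∑ x, ((d : ℝ) / N) * (star (φ x) ⬝ᵥ Pt.mulVec (φ x)).re / Pt.trace.re = 1) ∧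
    (-∑ x, (((d : ℝ) / N) * (star (φ x) ⬝ᵥ Pt.mulVec (φ x)).re / Pt.trace.re) *
        Real.logb 2 (((d : ℝ) / N) * (star (φ x) ⬝ᵥ Pt.mulVec (φ x)).re / Pt.trace.re)
      ≥ Real.logb 2 (((N : ℝ) * ((d : ℝ) + 1) / (d : ℝ)) * Pt.trace.re ^ 2 /
          (Pt.trace.re ^ 2 + (Pt * Pt).trace.re))) := by
  have hd0 : (0 : ℝ) < d := by exact_mod_cast hd
  have hN0 : (0 : ℝ) < N := by exact_mod_cast hN
  set e : Fin N → ℝ := fun x => (star (φ x) ⬝ᵥ Pt.mulVec (φ x)).re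
  have he0 : ∀ x, 0 ≤ e x := fun x => (Complex.le_def.1 (hPt.dotProduct_mulVec_nonneg (φ x))).1
  have heC : ∀ x, star (φ x) ⬝ᵥ Pt.mulVec (φ x) = (e x : ℂ) := fun x =>
    Complex.ext rfl (by simpa using (Complex.le_def.1 (hPt.dotProduct_mulVec_nonneg (φ x))).2.symm)
  have ht0 : 0 < Pt.trace.re := by
    have hnonneg := Complex.le_def.1 hPt.trace_nonneg
    refine lt_of_le_of_ne hnonneg.1 fun h => hPtne (hPt.trace_eq_zero_iff.1 ?_)
    exact Complex.ext h.symm hnonneg.2.symm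
  have htC : Pt.trace = (Pt.trace.re : ℂ) :=
    Complex.ext rfl (by simpa using (Complex.le_def.1 hPt.trace_nonneg).2.symm)
  have hfirst : ∑ x, e x = N / d * Pt.trace.re := by
    have h := congrArg Complex.re (hdesign.sum_expectation hd Pt)
    simp only [heC, hunif, ← Complex.ofReal_mul, ← Complex.ofReal_sum, ← Finset.mul_sum] at h
    rw [htC, show (d : ℂ)⁻¹ = ((d : ℝ)⁻¹ : ℝ) by push_cast; rfl, ← Complex.ofReal_mul,
      Complex.ofReal_re, Complex.ofReal_re] at h
    field_simp at h ⊢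
    linarith
  have hsecond : ∑ x, e x ^ 2 =
      N / (d * (d + 1)) * (Pt.trace.re ^ 2 + (Pt * Pt).trace.re) := by
    have h := congrArg Complex.re (hdesign.sum_expectation_mul Pt Pt)
    simp only [heC, hunif, ← Complex.ofReal_mul, ← Complex.ofReal_sum, ← Finset.mul_sum] at h
    rw [htC, show ((d : ℂ) * ((d : ℂ) + 1))⁻¹ = (((d : ℝ) * ((d : ℝ) + 1))⁻¹ : ℝ) by push_cast; rfl,
      Complex.re_ofReal_mul, Complex.add_re, ← Complex.ofReal_mul, Complex.ofReal_re,
      Complex.ofReal_re] at h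
    simp only [← pow_two] at h ⊢
    field_simp at h ⊢
    linarith
  have hq0 : ∀ x, 0 ≤ (d : ℝ) / N * e x / Pt.trace.re := fun x => by
    have := he0 x
    positivity
  have hq1 : ∑ x, (d : ℝ) / N * e x / Pt.trace.re = 1 := by
    rw [← Finset.sum_div, ← Finset.mul_sum, hfirst]
    field_simp
  refine ⟨hq0, hq1, ?_⟩
  convert logb_inv_sum_sq_le_entropy _ hq0 hq1 using 2
  simp only [div_pow, mul_pow]
  rw [← Finset.sum_div, ← Finset.mul_sum, hsecond, inv_div]
  field_simp
end

section
/- Let d ≥ 1, N ≥ 1, and let (q_y = 1/N, π_y)_{y=1}^N be a uniformly distributed 2-design in dimension d, so that P = {Π_y = (d/N)|π_y⟩⟨π_y|} is a POVM. Let ρ be a nonzero positive semidefinite d×d complex matrix with Tr[ρ] ≤ 1. Then the numbers q_{y|ρ} := (d/N)·⟨π_y, ρ π_y⟩ / Tr[ρ] form a probability distribution, and its Shannon entropy satisfies H ≥ log₂( (N(d+1)/d) · Tr[ρ]² / (Tr[ρ]² + Tr[ρ²]) ). -/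
open Matrix Finset
open scoped Kronecker BigOperators ComplexOrder

/-- The Shannon entropy of a probability vector is at least its collision entropy. -/
theorem neg_logb_sum_sq_le_entropy {ι : Type*} [Fintype ι] (r : ι → ℝ) (hr : ∀ i, 0 ≤ r i)
    (hsum : ∑ i, r i = 1) :
    Real.logb 2 (∑ i, r i ^ 2)⁻¹ ≤ -∑ i, r i * Real.logb 2 (r i) := by
  have hX : 0 < ∑ i, r i ^ 2 := by
    obtain ⟨i, -, hi⟩ := Finset.exists_ne_zero_of_sum_ne_zero (hsum.trans_ne one_ne_zero)
    exact Finset.sum_pos' (fun i _ => sq_nonneg (r i)) ⟨i, Finset.mem_univ i, by positivity⟩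
  set X := ∑ i, r i ^ 2 with hXdef
  have key (i : ι) : r i * Real.log (r i) - r i * Real.log X ≤ r i ^ 2 / X - r i := by
    rcases (hr i).eq_or_lt with h | h
    · simp [← h]
    · have := mul_le_mul_of_nonneg_left (Real.log_le_sub_one_of_pos (div_pos h hX)) h.le
      rw [Real.log_div h.ne' hX.ne'] at this
      calc _ = r i * (Real.log (r i) - Real.log X) := by ring
        _ ≤ _ := this
        _ = _ := by ring
  have hle := Finset.sum_le_sum fun i (_ : i ∈ Finset.univ) => key i
  rw [Finset.sum_sub_distrib, Finset.sum_sub_distrib, ← Finset.sum_mul, ← Finset.sum_div,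
    ← hXdef, hsum, div_self hX.ne', one_mul] at hle
  simp only [Real.logb, Real.log_inv, ← mul_div_assoc, ← Finset.sum_div, ← neg_div]
  exact div_le_div_of_nonneg_right (by linarith) (Real.log_nonneg one_le_two)

theorem trace_outerProd_mul {d : ℕ} (φ : Fin d → ℂ) (A : Matrix (Fin d) (Fin d) ℂ) :
    (outerProd φ * A).trace = star φ ⬝ᵥ A *ᵥ φ := by
  rw [outerProd, Matrix.trace_mul_comm, Matrix.mul_vecMulVec, Matrix.trace_vecMulVec,
    dotProduct_comm]

theorem trace_swapMatrix_mul_kronecker {d : ℕ} (A B : Matrix (Fin d) (Fin d) ℂ) :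
    (swapMatrix d * (A ⊗ₖ B)).trace = (A * B).trace := by
  simp only [Matrix.trace, Matrix.diag, Matrix.mul_apply, swapMatrix, Matrix.of_apply,
    Matrix.kroneckerMap_apply, Fintype.sum_prod_type, ite_and, ite_mul, one_mul, zero_mul]
  rw [Finset.sum_comm]
  simp

/-- A 2-design computes second moments of quadratic forms. -/
theorem IsTwoDesign.sum_mul {d N : ℕ} {p : Fin N → ℝ} {φ : Fin N → Fin d → ℂ}
    (h : IsTwoDesign p φ) (A B : Matrix (Fin d) (Fin d) ℂ) :
    ∑ x, (p x : ℂ) * ((star (φ x) ⬝ᵥ A *ᵥ φ x) * (star (φ x) ⬝ᵥ B *ᵥ φ x)) =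
      ((d : ℂ) * ((d : ℂ) + 1))⁻¹ * (A.trace * B.trace + (A * B).trace) := by
  have := congrArg (fun M => (M * (A ⊗ₖ B)).trace) h.2.2.2
  simpa [Finset.sum_mul, Matrix.trace_sum, Matrix.add_mul, Matrix.trace_add, mul_add,
    trace_swapMatrix_mul_kronecker, ← Matrix.mul_kronecker_mul, Matrix.trace_kronecker,
    trace_outerProd_mul] using this

/-- A 2-design computes first moments of quadratic forms. -/
theorem IsTwoDesign.sum_eq_trace_div {d N : ℕ} (hd : 1 ≤ d) {p : Fin N → ℝ}
    {φ : Fin N → Fin d → ℂ} (h : IsTwoDesign p φ) (A : Matrix (Fin d) (Fin d) ℂ) :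
    ∑ x, (p x : ℂ) * (star (φ x) ⬝ᵥ A *ᵥ φ x) = A.trace / d := by
  have := h.sum_mul A 1
  simp only [Matrix.one_mulVec, h.2.2.1, mul_one, Matrix.trace_one, Fintype.card_fin] at this
  have hd0 : (d : ℂ) ≠ 0 := by exact_mod_cast (by lia : d ≠ 0)
  have hd1 : (d : ℂ) + 1 ≠ 0 := by exact_mod_cast d.succ_ne_zero
  rw [this]
  field_simp

/-- Entropic bound for uniformly distributed 2-design POVMs: for any nonzero state `ρ`
(PSD with `Tr[ρ] ≤ 1`), the outcome probabilities `q_{y|ρ} = (d/N)⟨π_y, ρ π_y⟩/Tr[ρ]`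
form a probability distribution whose Shannon entropy is at least
`log₂( (N(d+1)/d)·Tr[ρ]²/(Tr[ρ]² + Tr[ρ²]) )`. -/
theorem entropy_bound_two_design_povm {d N : ℕ} (hd : 1 ≤ d) (hN : 1 ≤ N)
    (q : Fin N → ℝ) (π : Fin N → Fin d → ℂ)
    (hdesign : IsTwoDesign q π) (hunif : ∀ y, q y = 1 / N)
    (ρ : Matrix (Fin d) (Fin d) ℂ) (hρ : ρ.PosSemidef) (hρtr : ρ.trace ≤ 1)
    (hρne : ρ ≠ 0) :
    (∑ y, ((d : ℂ) / (N : ℂ)) • outerProd (π y) = 1) ∧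
    (∀ y, 0 ≤ ((d : ℝ) / N) * (star (π y) ⬝ᵥ ρ.mulVec (π y)).re / ρ.trace.re) ∧
    (∑ y, ((d : ℝ) / N) * (star (π y) ⬝ᵥ ρ.mulVec (π y)).re / ρ.trace.re = 1) ∧
    (-∑ y, (((d : ℝ) / N) * (star (π y) ⬝ᵥ ρ.mulVec (π y)).re / ρ.trace.re) *
        Real.logb 2 (((d : ℝ) / N) * (star (π y) ⬝ᵥ ρ.mulVec (π y)).re / ρ.trace.re)
      ≥ Real.logb 2 (((N : ℝ) * ((d : ℝ) + 1) / (d : ℝ)) * ρ.trace.re ^ 2 /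
          (ρ.trace.re ^ 2 + (ρ * ρ).trace.re))) := by
  have hd0 : (d : ℂ) ≠ 0 := by exact_mod_cast (by lia : d ≠ 0)
  have hN0 : (N : ℂ) ≠ 0 := by exact_mod_cast (by lia : N ≠ 0)
  have hdR : (0 : ℝ) < d := by exact_mod_cast hd
  have hNR : (0 : ℝ) < N := by exact_mod_cast hN
  have hT : 0 < ρ.trace.re := by
    have h0 := Complex.nonneg_iff.mp hρ.trace_nonneg
    refine h0.1.lt_of_ne fun h => hρne (hρ.trace_eq_zero_iff.mp ?_)
    exact Complex.ext h.symm h0.2.symm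
  have hTre : (ρ.trace.re : ℂ) = ρ.trace :=
    Complex.ext rfl (Complex.nonneg_iff.mp hρ.trace_nonneg).2
  have hquad (y : Fin N) := Complex.nonneg_iff.mp (hρ.dotProduct_mulVec_nonneg (π y))
  have hquadre (y : Fin N) : ((star (π y) ⬝ᵥ ρ *ᵥ π y).re : ℂ) = star (π y) ⬝ᵥ ρ *ᵥ π y :=
    Complex.ext rfl (hquad y).2
  have hqN (y : Fin N) : (q y : ℂ) = 1 / N := by rw [hunif]; push_cast; rfl
  have hmean : ∑ y, (star (π y) ⬝ᵥ ρ *ᵥ π y).re = N / d * ρ.trace.re := by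
    have h := hdesign.sum_eq_trace_div hd ρ
    simp only [hqN, ← Finset.mul_sum] at h
    apply Complex.ofReal_injective
    push_cast
    simp only [hquadre, hTre]
    field_simp at h ⊢
    linear_combination h
  have hsq : ∑ y, (star (π y) ⬝ᵥ ρ *ᵥ π y).re ^ 2 =
      N / (d * (d + 1)) * (ρ.trace.re ^ 2 + (ρ * ρ).trace.re) := by
    have h := congrArg Complex.re (hdesign.sum_mul ρ ρ)
    have hR : ∑ y, 1 / (N : ℝ) * (star (π y) ⬝ᵥ ρ *ᵥ π y).re ^ 2 =
        ((d : ℝ) * (d + 1))⁻¹ * (ρ.trace.re ^ 2 + (ρ * ρ).trace.re) := by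
      convert h using 1
      · rw [Complex.re_sum]
        refine Finset.sum_congr rfl fun y _ => ?_
        rw [← hquadre, hunif, ← Complex.ofReal_mul, ← Complex.ofReal_mul, Complex.ofReal_re,
          Complex.ofReal_re, sq]
      · rw [← hTre, ← Complex.ofReal_mul]
        have : ((d : ℂ) * (d + 1))⁻¹ = (((d : ℝ) * (d + 1))⁻¹ : ℝ) := by push_cast; rfl
        rw [this, Complex.re_ofReal_mul, Complex.add_re, Complex.ofReal_re, Complex.ofReal_re, sq]
    rw [← Finset.mul_sum] at hR
    field_simp at hR ⊢
    linear_combination hR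
  have hnonneg (y : Fin N) :
      0 ≤ ((d : ℝ) / N) * (star (π y) ⬝ᵥ ρ.mulVec (π y)).re / ρ.trace.re :=
    div_nonneg (mul_nonneg (by positivity) (hquad y).1) hT.le
  have hone : ∑ y, ((d : ℝ) / N) * (star (π y) ⬝ᵥ ρ.mulVec (π y)).re / ρ.trace.re = 1 := by
    rw [← Finset.sum_div, ← Finset.mul_sum, hmean]
    field_simp
  refine ⟨?_, hnonneg, hone, ?_⟩
  · ext i j
    have h := hdesign.sum_eq_trace_div hd (Matrix.single j i 1)
    simp only [← trace_outerProd_mul, Matrix.trace_mul_single, hqN, ← Finset.mul_sum] at h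
    simp only [MulOpposite.op_one, one_smul] at h
    have htr : (Matrix.single j i (1 : ℂ)).trace = (1 : Matrix (Fin d) (Fin d) ℂ) i j := by
      rw [Matrix.one_apply]
      split_ifs with hij
      · rw [hij, Matrix.trace_single_eq_same]
      · exact Matrix.trace_single_eq_of_ne _ _ _ (Ne.symm hij)
    rw [htr] at h
    simp only [Matrix.sum_apply, Matrix.smul_apply, smul_eq_mul, ← Finset.mul_sum]
    field_simp at h ⊢
    linear_combination h
  · refine le_of_eq_of_le ?_ (neg_logb_sum_sq_le_entropy _ hnonneg hone)
    congr 1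
    simp only [div_pow, mul_pow, ← Finset.sum_div, ← Finset.mul_sum, hsq]
    field_simp
end

section
/- Let d ≥ 1, N ≥ 1, and let (q_y = 1/N, π_y)_{y=1}^N be a uniformly distributed 2-design in dimension d, defining the POVM P = {Π_y = (d/N)|π_y⟩⟨π_y|}. Then for every ensemble E = {ρ_x} in dimension d, the mutual information satisfies I(E, P) ≤ log₂( 2d/(d+1) ). In particular the informational power of any uniformly distributed d-dimensional 2-design POVM is at most log₂(2d/(d+1)) < 1 bit. -/
open Matrix Finset
open scoped Kronecker BigOperators ComplexOrder

/-- The mutual information (in bits) of a finite joint probability distribution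
`p : X → Y → ℝ`, with the convention `0·log₂ 0 = 0` (terms with `p x y = 0` vanish). -/
noncomputable def mutualInfo {X Y : Type*} [Fintype X] [Fintype Y] (p : X → Y → ℝ) : ℝ :=
  ∑ x, ∑ y, p x y * Real.logb 2 (p x y / ((∑ y', p x y') * (∑ x', p x' y)))

/-- A joint distribution whose rows have small second moments has small mutual information. -/
theorem mutualInfo_le_logb {X Y : Type*} [Fintype X] [Fintype Y] (p : X → Y → ℝ)
    (hp : ∀ x y, 0 ≤ p x y) (hsum : ∑ x, ∑ y, p x y = 1) {c : ℝ} (hc : 0 < c)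
    (hsq : ∀ x, Fintype.card Y * ∑ y, p x y ^ 2 ≤ c * (∑ y, p x y) ^ 2) :
    mutualInfo p ≤ Real.logb 2 c := by
  have hY : (0 : ℝ) < Fintype.card Y := by
    rw [Nat.cast_pos, Fintype.card_pos_iff]
    by_contra h
    rw [not_nonempty_iff] at h
    simp at hsum
  set n : ℝ := (Fintype.card Y : ℝ)
  set r : X → ℝ := fun x => ∑ y, p x y with hr
  set s : Y → ℝ := fun y => ∑ x, p x y with hs
  have hterm : ∀ x y, p x y * Real.log (p x y / (r x * s y)) ≤
      p x y ^ 2 * (n / (c * r x)) - 2 * p x y + p x y * Real.log c + p x y * (n * s y)⁻¹ := by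
    intro x y
    rcases (hp x y).eq_or_lt with h | h
    · simp [← h]
    have hrx : 0 < r x := h.trans_le (single_le_sum (fun y _ => hp x y) (mem_univ y))
    have hsy : 0 < s y :=
      h.trans_le (single_le_sum (f := fun x => p x y) (fun x _ => hp x y) (mem_univ x))
    have hsplit : Real.log (p x y / (r x * s y)) =
        Real.log (n * p x y / (c * r x)) + Real.log c + Real.log (n * s y)⁻¹ := by
      rw [← Real.log_mul (by positivity) (by positivity),
        ← Real.log_mul (by positivity) (by positivity)]
      congr 1
      field_simp
    have h₁ := Real.log_le_sub_one_of_pos (x := n * p x y / (c * r x)) (by positivity)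
    have h₂ := Real.log_le_sub_one_of_pos (x := (n * s y)⁻¹) (by positivity)
    calc p x y * Real.log (p x y / (r x * s y))
        ≤ p x y * ((n * p x y / (c * r x) - 1) + Real.log c + ((n * s y)⁻¹ - 1)) := by
          rw [hsplit]; gcongr
      _ = _ := by ring
  have hrows : ∑ x, ∑ y, p x y ^ 2 * (n / (c * r x)) ≤ 1 := by
    rw [← hsum]
    refine sum_le_sum fun x _ => ?_
    rw [← sum_mul]
    rcases (sum_nonneg fun y _ => hp x y : 0 ≤ r x).eq_or_lt with h | h
    · change 0 = r x at h
      change _ ≤ r x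
      rw [← h]
      simp
    · rw [mul_div_assoc', div_le_iff₀ (by positivity), mul_comm _ n]
      exact (hsq x).trans_eq (by simp only [hr]; ring)
  have hcols : ∑ x, ∑ y, p x y * (n * s y)⁻¹ ≤ 1 := by
    rw [sum_comm]
    calc ∑ y, ∑ x, p x y * (n * s y)⁻¹ = ∑ y, s y * (n * s y)⁻¹ := by simp only [← sum_mul, hs]
      _ ≤ ∑ _y : Y, n⁻¹ := by
        refine sum_le_sum fun y _ => ?_
        rw [mul_inv, mul_left_comm]
        exact mul_le_of_le_one_right (by positivity) mul_inv_le_one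
      _ = 1 := by simp [n, hY.ne']
  have hlog : ∑ x, ∑ y, p x y * Real.log (p x y / (r x * s y)) ≤ Real.log c := by
    refine (sum_le_sum fun x _ => sum_le_sum fun y _ => hterm x y).trans ?_
    simp only [sum_add_distrib, sum_sub_distrib, ← mul_sum, ← sum_mul]
    rw [show ∑ x, ∑ y, p x y = 1 from hsum]
    simp only [← sum_mul] at hrows
    linarith
  calc mutualInfo p = (∑ x, ∑ y, p x y * Real.log (p x y / (r x * s y))) / Real.log 2 := by
        simp only [mutualInfo, Real.logb, sum_div, mul_div_assoc, hr, hs]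
    _ ≤ Real.logb 2 c := by
        rw [Real.logb]
        have := Real.log_pos one_lt_two
        gcongr

/-- The second moment identity characterising 2-designs. -/
theorem IsTwoDesign.sum_trace_mul_trace {d N : ℕ} {q : Fin N → ℝ} {π : Fin N → Fin d → ℂ}
    (h : IsTwoDesign q π) (A B : Matrix (Fin d) (Fin d) ℂ) :
    ∑ y, (q y : ℂ) * ((A * outerProd (π y)).trace * (B * outerProd (π y)).trace) =
      ((d : ℂ) * (d + 1))⁻¹ * (A.trace * B.trace + (A * B).trace) := by
  have := congrArg (fun M => ((A ⊗ₖ B) * M).trace) h.2.2.2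
  simpa only [Matrix.mul_sum, Matrix.trace_sum, Matrix.mul_smul, Matrix.trace_smul, smul_eq_mul,
    ← Matrix.mul_kronecker_mul, Matrix.trace_kronecker, Matrix.mul_add, Matrix.trace_add,
    Matrix.mul_one, trace_kronecker_mul_swapMatrix] using this

theorem trace_outerProd {d : ℕ} (φ : Fin d → ℂ) : (outerProd φ).trace = star φ ⬝ᵥ φ := by
  rw [outerProd, Matrix.trace_vecMulVec, dotProduct_comm]

/-- The first moment identity satisfied by 2-designs. -/
theorem IsTwoDesign.sum_trace {d N : ℕ} (hd : 1 ≤ d) {q : Fin N → ℝ} {π : Fin N → Fin d → ℂ}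
    (h : IsTwoDesign q π) (A : Matrix (Fin d) (Fin d) ℂ) :
    ∑ y, (q y : ℂ) * (A * outerProd (π y)).trace = A.trace / d := by
  have hd₀ : (d : ℂ) ≠ 0 := by exact_mod_cast (by omega : d ≠ 0)
  have hd₁ : (d : ℂ) + 1 ≠ 0 := by exact_mod_cast d.succ_ne_zero
  have := h.sum_trace_mul_trace A 1
  simp only [Matrix.one_mul, trace_outerProd, h.2.2.1, mul_one,
    Matrix.trace_one, Fintype.card_fin] at this
  rw [this]
  field_simp

theorem Matrix.PosSemidef.trace_mul_outerProd_nonneg {d : ℕ} {A : Matrix (Fin d) (Fin d) ℂ}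
    (hA : A.PosSemidef) (φ : Fin d → ℂ) : 0 ≤ (A * outerProd φ).trace := by
  rw [outerProd, Matrix.mul_vecMulVec, Matrix.trace_vecMulVec, dotProduct_comm]
  exact hA.dotProduct_mulVec_nonneg φ

theorem Matrix.PosSemidef.re_trace_mul_self_le {n : Type*} [Fintype n] [DecidableEq n]
    {A : Matrix n n ℂ} (hA : A.PosSemidef) : (A * A).trace.re ≤ A.trace.re ^ 2 := by
  have hsq : (A * A).trace = ∑ i, (hA.1.eigenvalues i : ℂ) ^ 2 := by
    conv_lhs => rw [hA.1.spectral_theorem, ← map_mul, Unitary.conjStarAlgAut_apply,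
      Matrix.trace_mul_cycle, Unitary.coe_star_mul_self, one_mul, Matrix.diagonal_mul_diagonal,
      Matrix.trace_diagonal]
    simp [sq]
  have h₁ : (A * A).trace.re = ∑ i, hA.1.eigenvalues i ^ 2 := by rw [hsq]; norm_cast
  have h₂ : A.trace.re = ∑ i, hA.1.eigenvalues i := by
    rw [hA.1.trace_eq_sum_eigenvalues]; simp
  rw [h₁, h₂]
  exact sum_sq_le_sq_sum_of_nonneg fun i _ => hA.eigenvalues_nonneg i

/-- Informational power bound for uniformly distributed 2-design POVMs: for the POVM
`P = {Π_y = (d/N)|π_y⟩⟨π_y|}` arising from a uniform 2-design and any ensemble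
`{ρ_x}`, the mutual information satisfies `I(E,P) ≤ log₂(2d/(d+1)) < 1` bit. -/
theorem informational_power_bound_two_design {d N : ℕ} (hd : 1 ≤ d) (hN : 1 ≤ N)
    (q : Fin N → ℝ) (π : Fin N → Fin d → ℂ)
    (hdesign : IsTwoDesign q π) (hunif : ∀ y, q y = 1 / N)
    {m : ℕ} (ρ : Fin m → Matrix (Fin d) (Fin d) ℂ)
    (hρpsd : ∀ x, (ρ x).PosSemidef) (hρtr : ∑ x, (ρ x).trace = 1) :
    mutualInfo (fun x y => (ρ x * (((d : ℂ) / (N : ℂ)) • outerProd (π y))).trace.re)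
      ≤ Real.logb 2 (2 * (d : ℝ) / ((d : ℝ) + 1)) ∧
    Real.logb 2 (2 * (d : ℝ) / ((d : ℝ) + 1)) < 1 := by
  have hd₀ : (0 : ℝ) < d := by exact_mod_cast hd
  have hN₀ : (0 : ℝ) < N := by exact_mod_cast hN
  refine ⟨?_, ?_⟩
  · set w : Fin m → Fin N → ℝ := fun x y => (ρ x * outerProd (π y)).trace.re with hw
    have hw₀ : ∀ x y, 0 ≤ w x y := fun x y =>
      (Complex.le_def.1 ((hρpsd x).trace_mul_outerProd_nonneg (π y))).1
    have hwc : ∀ x y, (ρ x * outerProd (π y)).trace = (w x y : ℂ) := fun x y =>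
      Complex.eq_re_of_ofReal_le ((hρpsd x).trace_mul_outerProd_nonneg (π y))
    have htr : ∀ x, (ρ x).trace = ((ρ x).trace.re : ℂ) := fun x =>
      Complex.eq_re_of_ofReal_le (hρpsd x).trace_nonneg
    have hp : (fun x y => (ρ x * (((d : ℂ) / (N : ℂ)) • outerProd (π y))).trace.re) =
        fun x y => (d / N : ℝ) * w x y := by
      funext x y
      rw [Matrix.mul_smul, Matrix.trace_smul, smul_eq_mul, hwc,
        show (d : ℂ) / N = ((d / N : ℝ) : ℂ) by push_cast; rfl, Complex.re_ofReal_mul,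
        Complex.ofReal_re]
    have hrow : ∀ x, ∑ y, (d / N : ℝ) * w x y = (ρ x).trace.re := by
      intro x
      have h := hdesign.sum_trace hd (ρ x)
      simp only [hwc, hunif] at h
      rw [htr x] at h
      norm_cast at h
      rw [← mul_sum] at h ⊢
      field_simp at h ⊢
      linarith
    have hsq : ∀ x, (N : ℝ)⁻¹ * ∑ y, w x y ^ 2 =
        ((d : ℝ) * (d + 1))⁻¹ * ((ρ x).trace.re ^ 2 + (ρ x * ρ x).trace.re) := by
      intro x
      have h := hdesign.sum_trace_mul_trace (ρ x) (ρ x)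
      simp only [hwc, hunif] at h
      rw [htr x] at h
      have h' := congrArg Complex.re h
      rw [show ((d : ℂ) * (d + 1))⁻¹ = (((d : ℝ) * (d + 1))⁻¹ : ℝ) by push_cast; rfl,
        Complex.re_ofReal_mul, Complex.add_re, ← Complex.ofReal_mul, Complex.ofReal_re] at h'
      rw [sq (ρ x).trace.re, ← h', mul_sum]
      norm_cast
      simp [sq]
    rw [hp]
    refine mutualInfo_le_logb _ (fun x y => mul_nonneg (by positivity) (hw₀ x y)) ?_
      (by positivity) fun x => ?_
    · simp only [hrow]
      rw [← Complex.re_sum, hρtr, Complex.one_re]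
    · calc (Fintype.card (Fin N) : ℝ) * ∑ y, ((d / N : ℝ) * w x y) ^ 2
          = (d : ℝ) ^ 2 * ((N : ℝ)⁻¹ * ∑ y, w x y ^ 2) := by
            simp only [mul_pow, ← mul_sum, Fintype.card_fin]
            field_simp
        _ ≤ (d : ℝ) ^ 2 * (((d : ℝ) * (d + 1))⁻¹ * ((ρ x).trace.re ^ 2 + (ρ x).trace.re ^ 2)) := by
            rw [hsq]
            gcongr
            exact (hρpsd x).re_trace_mul_self_le
        _ = 2 * d / (d + 1) * (∑ y, (d / N : ℝ) * w x y) ^ 2 := by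
            rw [hrow]
            field_simp
            ring
  · rw [Real.logb_lt_iff_lt_rpow one_lt_two (by positivity), Real.rpow_one,
      div_lt_iff₀ (by positivity)]
    linarith
end

section
/- Let ω = e^{2πi/3} and ξ = e^{iπ/3}. Let E be the ensemble in dimension 3 consisting of the 12 states (1/12)|φ_x⟩⟨φ_x|, where the φ_x are the unit vectors e₁, e₂, e₃ and (1/√3)(1,1,1), (1/√3)(1,ω,ω²), (1/√3)(1,ω²,ω), (1/√3)(1,ω,ω), (1/√3)(1,ω²,1), (1/√3)(1,1,ω²), (1/√3)(1,ω²,ω²), (1/√3)(1,ω,1), (1/√3)(1,1,ω) (the 4-MUB ensemble in dimension 3). Let Q be the POVM consisting of the 9 effects (1/3)|ψ_y⟩⟨ψ_y|, where the ψ_y are the unit vectors (1/√2)(0,−1,1), (1/√2)(0,ξ,1), (1/√2)(0,ξ*,1), (1/√2)(1,0,−1), (1/√2)(1,0,ξ), (1/√2)(1,0,ξ*), (1/√2)(−1,1,0), (1/√2)(ξ,1,0), (1/√2)(ξ*,1,0) (a SIC POVM in dimension 3). Then the mutual information equals exactly I(E, Q) = log₂(3/2); combined with the 2-design upper bound this shows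 the accessible information of the 3-dimensional 4-MUB ensemble is exactly log₂(3/2). -/
open Matrix Finset
open scoped BigOperators ComplexOrder

/-- `ω = e^{2πi/3}`. -/
noncomputable def ω : ℂ := Complex.exp (2 * Real.pi * Complex.I / 3)

/-- `ξ = e^{iπ/3}`. -/
noncomputable def ξ : ℂ := Complex.exp (Real.pi * Complex.I / 3)

/-- The 12 unit vectors of the (unique) maximal set of 4 mutually unbiased bases in
dimension 3. -/
noncomputable def mub3Vecs : Fin 12 → Fin 3 → ℂ :=
  ![![1, 0, 0], ![0, 1, 0], ![0, 0, 1],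
    ((Real.sqrt 3 : ℂ))⁻¹ • ![1, 1, 1],
    ((Real.sqrt 3 : ℂ))⁻¹ • ![1, ω, ω ^ 2],
    ((Real.sqrt 3 : ℂ))⁻¹ • ![1, ω ^ 2, ω],
    ((Real.sqrt 3 : ℂ))⁻¹ • ![1, ω, ω],
    ((Real.sqrt 3 : ℂ))⁻¹ • ![1, ω ^ 2, 1],
    ((Real.sqrt 3 : ℂ))⁻¹ • ![1, 1, ω ^ 2],
    ((Real.sqrt 3 : ℂ))⁻¹ • ![1, ω ^ 2, ω ^ 2],
    ((Real.sqrt 3 : ℂ))⁻¹ • ![1, ω, 1],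
    ((Real.sqrt 3 : ℂ))⁻¹ • ![1, 1, ω]]

/-- The 9 unit vectors of a symmetric informationally complete (SIC) set in dimension 3. -/
noncomputable def sic3Vecs : Fin 9 → Fin 3 → ℂ :=
  ![((Real.sqrt 2 : ℂ))⁻¹ • ![0, -1, 1],
    ((Real.sqrt 2 : ℂ))⁻¹ • ![0, ξ, 1],
    ((Real.sqrt 2 : ℂ))⁻¹ • ![0, (starRingEnd ℂ) ξ, 1],
    ((Real.sqrt 2 : ℂ))⁻¹ • ![1, 0, -1],
    ((Real.sqrt 2 : ℂ))⁻¹ • ![1, 0, ξ],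
    ((Real.sqrt 2 : ℂ))⁻¹ • ![1, 0, (starRingEnd ℂ) ξ],
    ((Real.sqrt 2 : ℂ))⁻¹ • ![-1, 1, 0],
    ((Real.sqrt 2 : ℂ))⁻¹ • ![ξ, 1, 0],
    ((Real.sqrt 2 : ℂ))⁻¹ • ![(starRingEnd ℂ) ξ, 1, 0]]

/-- The table of overlaps between the MUB vectors and the SIC vectors, in units of `1 / 2`. -/
def overlapTable : Fin 12 → Fin 9 → ℕ :=
  ![![0, 0, 0, 1, 1, 1, 1, 1, 1],
    ![1, 1, 1, 0, 0, 0, 1, 1, 1],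
    ![1, 1, 1, 1, 1, 1, 0, 0, 0],
    ![0, 1, 1, 0, 1, 1, 0, 1, 1],
    ![1, 0, 1, 1, 0, 1, 1, 0, 1],
    ![1, 1, 0, 1, 1, 0, 1, 1, 0],
    ![0, 1, 1, 1, 1, 0, 1, 0, 1],
    ![1, 0, 1, 0, 1, 1, 1, 1, 0],
    ![1, 1, 0, 1, 0, 1, 0, 1, 1],
    ![0, 1, 1, 1, 0, 1, 1, 1, 0],
    ![1, 1, 0, 0, 1, 1, 1, 0, 1],
    ![1, 0, 1, 1, 1, 0, 0, 1, 1]]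

lemma ω_eq : ω = ⟨-1 / 2, Real.sqrt 3 / 2⟩ := by
  have h : (2 * Real.pi * Complex.I / 3 : ℂ) = ((Real.pi - Real.pi / 3 : ℝ) : ℂ) * Complex.I := by
    push_cast; ring
  rw [ω, h]
  apply Complex.ext
  · rw [Complex.exp_ofReal_mul_I_re, Real.cos_pi_sub, Real.cos_pi_div_three]; norm_num
  · rw [Complex.exp_ofReal_mul_I_im, Real.sin_pi_sub, Real.sin_pi_div_three]

lemma ξ_eq : ξ = ⟨1 / 2, Real.sqrt 3 / 2⟩ := by
  have h : (Real.pi * Complex.I / 3 : ℂ) = ((Real.pi / 3 : ℝ) : ℂ) * Complex.I := by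
    push_cast; ring
  rw [ξ, h]
  apply Complex.ext
  · rw [Complex.exp_ofReal_mul_I_re, Real.cos_pi_div_three]
  · rw [Complex.exp_ofReal_mul_I_im, Real.sin_pi_div_three]

lemma ω_sq_eq : ω ^ 2 = ⟨-1 / 2, -(Real.sqrt 3 / 2)⟩ := by
  have h : Real.sqrt 3 * Real.sqrt 3 = 3 := Real.mul_self_sqrt (by norm_num)
  rw [ω_eq, sq]
  apply Complex.ext
  · simp only [Complex.mul_re]; linarith
  · simp only [Complex.mul_im]; ring

lemma trace_smul_outerProd_mul_smul_outerProd {d : ℕ} (a b : ℂ) (φ ψ : Fin d → ℂ) :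
    ((a • outerProd φ) * (b • outerProd ψ)).trace =
      a * b * (Complex.normSq (star φ ⬝ᵥ ψ) : ℂ) := by
  have h : star ψ ⬝ᵥ φ = (starRingEnd ℂ) (star φ ⬝ᵥ ψ) := by
    rw [starRingEnd_apply, Matrix.star_dotProduct]
  rw [Complex.normSq_eq_conj_mul_self, ← h, outerProd, outerProd, smul_mul_smul_comm,
    Matrix.vecMulVec_mul_vecMulVec, Matrix.trace_smul]
  simp [Matrix.trace_vecMulVec, dotProduct_comm, mul_comm]

set_option maxHeartbeats 4000000 in
lemma normSq_mub3Vecs_dotProduct_sic3Vecs (x : Fin 12) (y : Fin 9) :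
    Complex.normSq (star (mub3Vecs x) ⬝ᵥ sic3Vecs y) = overlapTable x y / 2 := by
  have h : Real.sqrt 3 ^ 2 = 3 := Real.sq_sqrt (by norm_num)
  have h' : Real.sqrt 3 ^ 4 = 9 := by rw [show 4 = 2 * 2 by rfl, pow_mul, h]; norm_num
  rw [mub3Vecs, sic3Vecs, ω_sq_eq, ω_eq, ξ_eq]
  fin_cases x <;> fin_cases y <;>
    simp [overlapTable, dotProduct, Fin.sum_univ_three, Complex.normSq_apply,
      ← Complex.ofReal_inv] <;>
    field_simp <;> ring_nf <;> norm_num [h, h']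

lemma mutualInfo_eq_logb {X Y : Type*} [Fintype X] [Fintype Y] {p : X → Y → ℝ} {a b c : ℝ}
    (hp : ∀ x y, p x y = 0 ∨ p x y = c) (hX : ∀ x, ∑ y, p x y = a) (hY : ∀ y, ∑ x, p x y = b)
    (htot : ∑ x, ∑ y, p x y = 1) : mutualInfo p = Real.logb 2 (c / (a * b)) := by
  have h : ∀ x y, p x y * Real.logb 2 (p x y / ((∑ y', p x y') * (∑ x', p x' y))) =
      p x y * Real.logb 2 (c / (a * b)) := by
    intro x y
    rw [hX, hY]
    rcases hp x y with h | h <;> simp [h]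
  simp only [mutualInfo, h, ← Finset.sum_mul, htot, one_mul]

/-- The mutual information between the 3-dimensional 4-MUB ensemble
`E = {(1/12)|φ_x⟩⟨φ_x|}` and the SIC POVM `Q = {(1/3)|ψ_y⟩⟨ψ_y|}` equals exactly
`log₂(3/2)`; this attains the 2-design upper bound on the accessible information. -/
theorem mub3_ensemble_sic_povm_mutual_info :
    mutualInfo (fun x y =>
        (((1 / 12 : ℂ) • outerProd (mub3Vecs x)) *
          ((1 / 3 : ℂ) • outerProd (sic3Vecs y))).trace.re)
      = Real.logb 2 (3 / 2) := by
  have hp : ∀ x y, (((1 / 12 : ℂ) • outerProd (mub3Vecs x)) *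
      ((1 / 3 : ℂ) • outerProd (sic3Vecs y))).trace.re = (overlapTable x y : ℝ) / 72 := by
    intro x y
    rw [trace_smul_outerProd_mul_smul_outerProd, normSq_mub3Vecs_dotProduct_sic3Vecs,
      show (1 / 12 * (1 / 3) : ℂ) = ((1 / 36 : ℝ) : ℂ) by norm_num, Complex.re_ofReal_mul,
      Complex.ofReal_re]
    ring
  have hX : ∀ x, ∑ y, overlapTable x y = 6 := by decide
  have hY : ∀ y, ∑ x, overlapTable x y = 8 := by decide
  have h01 : ∀ x y, overlapTable x y = 0 ∨ overlapTable x y = 1 := by decide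
  have hX' : ∀ x, ∑ y, (overlapTable x y : ℝ) / 72 = 1 / 12 := fun x ↦ by
    rw [← Finset.sum_div, ← Nat.cast_sum, hX]; norm_num
  have hY' : ∀ y, ∑ x, (overlapTable x y : ℝ) / 72 = 1 / 9 := fun y ↦ by
    rw [← Finset.sum_div, ← Nat.cast_sum, hY]; norm_num
  simp only [hp]
  rw [mutualInfo_eq_logb (c := 1 / 72) (fun x y ↦ ?_) hX' hY']
  · norm_num
  · simp [hX']
  · rcases h01 x y with h | h <;> simp [h]
end

section
/- Let d ≥ 1 and let E = {ρ_x = p_x|φ_x⟩⟨φ_x|} be an ensemble of pure states in dimension d (unit vectors φ_x ∈ ℂ^d and weights p_x ≥ 0 with Σ_x p_x = 1). Then for every POVM P = {Π_y} in dimension d, the mutual information satisfies I(E, P) ≤ log₂ d; i.e., the accessible information of any d-dimensional ensemble of pure states is at most log₂ d. -/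
open Matrix Finset
open scoped BigOperators ComplexOrder

theorem Matrix.IsHermitian.re_trace_mul_nonneg_of_isIdempotentElem {d : ℕ}
    {Q A : Matrix (Fin d) (Fin d) ℂ} (hQ : Q.IsHermitian) (hQQ : Q * Q = Q)
    (hA : A.PosSemidef) : 0 ≤ (Q * A).trace.re := by
  have h : (Q * A).trace = (Q * A * Qᴴ).trace := by
    rw [hQ.eq, Matrix.trace_mul_comm (Q * A) Q, ← Matrix.mul_assoc, hQQ]
  rw [h]
  exact (Complex.le_def.mp (hA.mul_mul_conjTranspose_same Q).trace_nonneg).1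

theorem outerProd_isHermitian {d : ℕ} (φ : Fin d → ℂ) : (outerProd φ).IsHermitian := by
  simp [outerProd, Matrix.IsHermitian, Matrix.conjTranspose_vecMulVec]

theorem outerProd_mul_self {d : ℕ} {φ : Fin d → ℂ} (h : star φ ⬝ᵥ φ = 1) :
    outerProd φ * outerProd φ = outerProd φ := by
  simp [outerProd, Matrix.vecMulVec_mul_vecMulVec, h]

theorem re_trace_outerProd_mul_nonneg {d : ℕ} {φ : Fin d → ℂ} (h : star φ ⬝ᵥ φ = 1)
    {A : Matrix (Fin d) (Fin d) ℂ} (hA : A.PosSemidef) :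
    0 ≤ (outerProd φ * A).trace.re :=
  (outerProd_isHermitian φ).re_trace_mul_nonneg_of_isIdempotentElem (outerProd_mul_self h) hA

theorem re_trace_outerProd_mul_le {d : ℕ} {φ : Fin d → ℂ} (h : star φ ⬝ᵥ φ = 1)
    {A : Matrix (Fin d) (Fin d) ℂ} (hA : A.PosSemidef) :
    (outerProd φ * A).trace.re ≤ A.trace.re := by
  have hH : (1 - outerProd φ).IsHermitian := Matrix.isHermitian_one.sub (outerProd_isHermitian φ)
  have hI : (1 - outerProd φ) * (1 - outerProd φ) = 1 - outerProd φ := by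
    simp [Matrix.sub_mul, Matrix.mul_sub, outerProd_mul_self h]
  have := hH.re_trace_mul_nonneg_of_isIdempotentElem hI hA
  simp only [Matrix.sub_mul, Matrix.one_mul, Matrix.trace_sub, Complex.sub_re] at this
  linarith

/-- If the conditional probabilities `w x y / ∑ y', w x y'` are bounded by `t y`, the mutual
information is at most `log₂ (∑ y, t y)`. -/
theorem mutualInfo_le_logb_of_le_mul {X Y : Type*} [Fintype X] [Fintype Y]
    {w : X → Y → ℝ} {t : Y → ℝ} {D : ℝ} (hw : ∀ x y, 0 ≤ w x y)
    (hw1 : ∑ x, ∑ y, w x y = 1) (ht : ∀ y, 0 ≤ t y) (hD : 0 < D) (htD : ∑ y, t y = D)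
    (hwt : ∀ x y, w x y ≤ (∑ y', w x y') * t y) :
    mutualInfo w ≤ Real.logb 2 D := by
  have hlog2 : 0 < Real.log 2 := Real.log_pos one_lt_two
  have hterm : ∀ x y, w x y * Real.logb 2 (w x y / ((∑ y', w x y') * (∑ x', w x' y))) ≤
      w x y * Real.logb 2 D + (w x y * (t y / (D * ∑ x', w x' y)) - w x y) / Real.log 2 := by
    intro x y
    rcases (hw x y).eq_or_lt with h0 | hpos
    · simp [← h0]
    have hr : 0 < ∑ y', w x y' :=
      hpos.trans_le (Finset.single_le_sum (fun y' _ => hw x y') (Finset.mem_univ y))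
    have hq : 0 < ∑ x', w x' y :=
      hpos.trans_le
        (Finset.single_le_sum (f := fun x' => w x' y) (fun x' _ => hw x' y) (Finset.mem_univ x))
    set r := ∑ y', w x y'
    set q := ∑ x', w x' y
    have hz : 0 < w x y / (r * q) := by positivity
    have hle : w x y / (r * q) / D ≤ t y / (D * q) := by
      rw [div_div, div_le_div_iff₀ (by positivity) (by positivity)]
      have := mul_le_mul_of_nonneg_right (hwt x y) (mul_pos hD hq).le
      nlinarith
    have hl := Real.log_le_sub_one_of_pos (div_pos hz hD)
    rw [Real.log_div hz.ne' hD.ne'] at hl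
    have hb : Real.log (w x y / (r * q)) ≤ Real.log D + (t y / (D * q) - 1) := by linarith
    have := mul_le_mul_of_nonneg_left hb hpos.le
    calc w x y * Real.logb 2 (w x y / (r * q))
        = w x y * Real.log (w x y / (r * q)) / Real.log 2 := by rw [Real.logb, mul_div_assoc]
      _ ≤ w x y * (Real.log D + (t y / (D * q) - 1)) / Real.log 2 := by gcongr
      _ = _ := by rw [Real.logb]; ring
  have hsum : ∑ x, ∑ y, w x y * (t y / (D * ∑ x', w x' y)) ≤ 1 := by
    rw [Finset.sum_comm]
    calc ∑ y, ∑ x, w x y * (t y / (D * ∑ x', w x' y)) ≤ ∑ y, t y / D := by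
          refine Finset.sum_le_sum fun y _ => ?_
          rw [← Finset.sum_mul]
          rcases eq_or_ne (∑ x', w x' y) 0 with h | h
          · rw [h, zero_mul]
            exact div_nonneg (ht y) hD.le
          · apply le_of_eq
            field_simp
      _ = 1 := by rw [← Finset.sum_div, htD, div_self hD.ne']
  calc mutualInfo w
      ≤ ∑ x, ∑ y, (w x y * Real.logb 2 D +
          (w x y * (t y / (D * ∑ x', w x' y)) - w x y) / Real.log 2) :=
        Finset.sum_le_sum fun x _ => Finset.sum_le_sum fun y _ => hterm x y
    _ = Real.logb 2 D +
          (∑ x, ∑ y, w x y * (t y / (D * ∑ x', w x' y)) - 1) / Real.log 2 := by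
        simp only [Finset.sum_add_distrib, ← Finset.sum_mul, ← Finset.sum_div,
          Finset.sum_sub_distrib, hw1, one_mul]
    _ ≤ Real.logb 2 D := by
        have := div_nonpos_of_nonpos_of_nonneg (sub_nonpos.mpr hsum) hlog2.le
        linarith

/-- Holevo bound for pure-state ensembles: for any ensemble
`E = {ρ_x = p_x|φ_x⟩⟨φ_x|}` of pure states in dimension `d` and any POVM `{Π_y}`,
the mutual information satisfies `I(E,P) ≤ log₂ d`. -/
theorem accessible_information_le_log_dim {d : ℕ} (hd : 1 ≤ d) {N : ℕ}
    (p : Fin N → ℝ) (φ : Fin N → Fin d → ℂ)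
    (hp : ∀ x, 0 ≤ p x) (hsum : ∑ x, p x = 1)
    (hunit : ∀ x, star (φ x) ⬝ᵥ φ x = 1)
    {M : ℕ} (Pt : Fin M → Matrix (Fin d) (Fin d) ℂ)
    (hPsd : ∀ y, (Pt y).PosSemidef) (hPsum : ∑ y, Pt y = 1) :
    mutualInfo (fun x y => (((p x : ℂ) • outerProd (φ x)) * Pt y).trace.re)
      ≤ Real.logb 2 d := by
  have hw : ∀ x y, (((p x : ℂ) • outerProd (φ x)) * Pt y).trace.re =
      p x * (outerProd (φ x) * Pt y).trace.re := by
    intro x y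
    rw [Matrix.smul_mul, Matrix.trace_smul, smul_eq_mul, Complex.re_ofReal_mul]
  have hrow : ∀ x, ∑ y, p x * (outerProd (φ x) * Pt y).trace.re = p x := by
    intro x
    have htr : (outerProd (φ x)).trace = 1 := by
      rw [outerProd, Matrix.trace_vecMulVec, dotProduct_comm, hunit x]
    rw [← Finset.mul_sum, ← Complex.re_sum, ← Matrix.trace_sum, ← Matrix.mul_sum, hPsum,
      Matrix.mul_one, htr, Complex.one_re, mul_one]
  simp only [hw]
  refine mutualInfo_le_logb_of_le_mul (t := fun y => (Pt y).trace.re)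
    (fun x y => mul_nonneg (hp x) (re_trace_outerProd_mul_nonneg (hunit x) (hPsd y))) ?_
    (fun y => (Complex.le_def.mp (hPsd y).trace_nonneg).1) (by exact_mod_cast hd) ?_ ?_
  · simp only [hrow, hsum]
  · rw [← Complex.re_sum, ← Matrix.trace_sum, hPsum]
    simp
  · intro x y
    rw [hrow]
    exact mul_le_mul_of_nonneg_left (re_trace_outerProd_mul_le (hunit x) (hPsd y)) (hp x)
end
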